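/- Let R be an augmented Noetherian semiperfect algebra with Jacobson radical J and let ξ : 0 → K → M → N → 0 be a short exact sequence of finitely generated R-modules for which the minimal Horseshoe Lemma holds. Then pd(M) = max{pd(K), pd(N)}, where pd denotes projective dimension (with the convention that the equality also covers the case where one of the dimensions is infinite). -/

import Mathlib

/-- `jSMul I K` is the submodule `I·K` generated by the products `r • k`,
`r ∈ I`, `k ∈ K`. -/
def jSMul {R : Type} [Ring R] {M : Type} [AddCommGroup M] [Module R M]
    (I : Ideal R) (K : Submodule R M) : Submodule R M :=
  Submodule.span R {x : M | ∃ r ∈ I, ∃ k ∈ K, x = r • k}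

/-- `jPowSMul I n K` is the submodule `Iⁿ·K`. -/
def jPowSMul {R : Type} [Ring R] {M : Type} [AddCommGroup M] [Module R M]
    (I : Ideal R) : ℕ → Submodule R M → Submodule R M
  | 0, K => K
  | n + 1, K => jSMul I (jPowSMul I n K)

/-- The Jacobson radical of a ring. -/
abbrev jacobsonRad (R : Type) [Ring R] : Ideal R := Ideal.jacobson (⊥ : Ideal R)

/-- A minimal projective resolution `⋯ → P₁ → P₀ → X → 0`. -/
structure MinProjRes (R : Type) [Ring R] (J : Ideal R)
    (X : Type) [AddCommGroup X] [Module R X] where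
  obj : ℕ → Type
  [addcomm : ∀ n, AddCommGroup (obj n)]
  [mod : ∀ n, Module R (obj n)]
  proj : ∀ n, Module.Projective R (obj n)
  fin : ∀ n, Module.Finite R (obj n)
  d : ∀ n, obj (n + 1) →ₗ[R] obj n
  aug : obj 0 →ₗ[R] X
  aug_surj : Function.Surjective aug
  exact0 : LinearMap.range (d 0) = LinearMap.ker aug
  exact : ∀ n, LinearMap.range (d (n + 1)) = LinearMap.ker (d n)
  minimal0 : LinearMap.ker aug ≤ jSMul J ⊤
  minimal : ∀ n, LinearMap.ker (d n) ≤ jSMul J ⊤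

attribute [instance] MinProjRes.addcomm MinProjRes.mod

/-- The syzygies of a minimal projective resolution: `P.syz n ⊆ Pₙ`
is the `(n+1)`-st syzygy `Ω^{n+1}(X) = ker dₙ`. -/
def MinProjRes.syz {R : Type} [Ring R] {J : Ideal R}
    {X : Type} [AddCommGroup X] [Module R X]
    (P : MinProjRes R J X) : ∀ n, Submodule R (P.obj n)
  | 0 => LinearMap.ker P.aug
  | n + 1 => LinearMap.ker (P.d n)

/-- A projective cover of a finitely generated module. -/
structure ProjCover (R : Type) [Ring R] (J : Ideal R)
    (X : Type) [AddCommGroup X] [Module R X] where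
  P : Type
  [addcomm : AddCommGroup P]
  [mod : Module R P]
  p : P →ₗ[R] X
  proj : Module.Projective R P
  fin : Module.Finite R P
  surj : Function.Surjective p
  ker_le : LinearMap.ker p ≤ jSMul J ⊤

attribute [instance] ProjCover.addcomm ProjCover.mod

/-- `R` is semiperfect: every finitely generated module has a projective cover. -/
def Semiperfect (R : Type) [Ring R] : Prop :=
  ∀ (X : Type) [AddCommGroup X] [Module R X], Module.Finite R X →
    Nonempty (ProjCover R (jacobsonRad R) X)

/-- The minimal Horseshoe Lemma holds for the short exact sequence
`0 → K →f→ M →g→ N → 0`. -/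
def MinimalHorseshoe {R : Type} [Ring R] (J : Ideal R)
    {K M N : Type} [AddCommGroup K] [Module R K] [AddCommGroup M] [Module R M]
    [AddCommGroup N] [Module R N] (f : K →ₗ[R] M) (g : M →ₗ[R] N) : Prop :=
  ∃ (P : MinProjRes R J K) (L : MinProjRes R J M) (Q : MinProjRes R J N)
    (φ : ∀ n, P.obj n →ₗ[R] L.obj n) (ψ : ∀ n, L.obj n →ₗ[R] Q.obj n),
    L.aug ∘ₗ φ 0 = f ∘ₗ P.aug ∧
    Q.aug ∘ₗ ψ 0 = g ∘ₗ L.aug ∧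
    (∀ n, L.d n ∘ₗ φ (n + 1) = φ n ∘ₗ P.d n) ∧
    (∀ n, Q.d n ∘ₗ ψ (n + 1) = ψ n ∘ₗ L.d n) ∧
    (∀ n, Function.Injective (φ n)) ∧
    (∀ n, Function.Surjective (ψ n)) ∧
    (∀ n, LinearMap.ker (ψ n) = LinearMap.range (φ n))

/-- `X` is a quasi-`δ`-Koszul module. -/
def IsQuasiDeltaKoszul {R : Type} [Ring R] (J : Ideal R) (δ : ℕ → ℕ)
    (X : Type) [AddCommGroup X] [Module R X] : Prop :=
  ∃ P : MinProjRes R J X, ∀ n,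
    P.syz n ≤ jPowSMul J (δ (n + 1) - δ n) ⊤ ∧
    jSMul J (P.syz n) = P.syz n ⊓ jPowSMul J (δ (n + 1) - δ n + 1) ⊤

/-- `X` is a quasi-Koszul module. -/
def IsQuasiKoszul {R : Type} [Ring R] (J : Ideal R)
    (X : Type) [AddCommGroup X] [Module R X] : Prop :=
  ∃ P : MinProjRes R J X, ∀ n,
    jSMul J (P.syz n) = P.syz n ⊓ jPowSMul J 2 ⊤
/-- A (not necessarily minimal) projective resolution `⋯ → P₁ → P₀ → X → 0`. -/
structure ProjRes (R : Type) [Ring R] (X : Type) [AddCommGroup X] [Module R X] where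
  obj : ℕ → Type
  [addcomm : ∀ n, AddCommGroup (obj n)]
  [mod : ∀ n, Module R (obj n)]
  proj : ∀ n, Module.Projective R (obj n)
  d : ∀ n, obj (n + 1) →ₗ[R] obj n
  aug : obj 0 →ₗ[R] X
  aug_surj : Function.Surjective aug
  exact0 : LinearMap.range (d 0) = LinearMap.ker aug
  exact : ∀ n, LinearMap.range (d (n + 1)) = LinearMap.ker (d n)

attribute [instance] ProjRes.addcomm ProjRes.mod

/-- The resolution has length at most `n`: all later terms vanish. -/
def ProjRes.LengthLE {R : Type} [Ring R] {X : Type} [AddCommGroup X]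
    [Module R X] (P : ProjRes R X) (n : ℕ) : Prop :=
  ∀ m, n < m → ∀ x : P.obj m, x = 0

/-- The projective dimension of `X`, as an element of `ℕ∞`. -/
noncomputable def projDim (R : Type) [Ring R] (X : Type) [AddCommGroup X]
    [Module R X] : ℕ∞ :=
  sInf {c : ℕ∞ | ∃ (n : ℕ) (P : ProjRes R X), c = n ∧ P.LengthLE n}

theorem jSMul_map_le {R : Type} [Ring R] (I : Ideal R) {A B : Type} [AddCommGroup A] [Module R A]
    [AddCommGroup B] [Module R B] (h : A →ₗ[R] B) (S : Submodule R A) :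
    (jSMul I S).map h ≤ jSMul I (S.map h) := by
  rw [jSMul, Submodule.map_span, Submodule.span_le]
  rintro _ ⟨_, ⟨r, hr, x, hx, rfl⟩, rfl⟩
  exact Submodule.subset_span ⟨r, hr, h x, ⟨x, hx, rfl⟩, map_smul h r x⟩

/-- Nakayama's lemma for `jSMul`. -/
theorem subsingleton_of_top_le_jSMul {R : Type} [Ring R] {A : Type} [AddCommGroup A] [Module R A]
    [Module.Finite R A] (h : (⊤ : Submodule R A) ≤ jSMul (jacobsonRad R) ⊤) : Subsingleton A := by
  refine (Submodule.subsingleton_iff R).mp (subsingleton_of_bot_eq_top (Eq.symm ?_))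
  refine Submodule.FG.eq_bot_of_le_jacobson_smul (R := R) Module.Finite.fg_top (h.trans ?_)
  refine Submodule.span_le.mpr ?_
  rintro _ ⟨r, hr, x, hx, rfl⟩
  rw [jacobsonRad, Ideal.jacobson_bot] at hr
  exact Submodule.smul_mem_smul hr hx

/-- A superfluous surjection onto a projective module is injective. -/
theorem subsingleton_ker_of_projective {R : Type} [Ring R] {A X : Type} [AddCommGroup A]
    [Module R A] [AddCommGroup X] [Module R X] [Module.Projective R X] (p : A →ₗ[R] X)
    [Module.Finite R (LinearMap.ker p)] (hp : Function.Surjective p)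
    (hker : LinearMap.ker p ≤ jSMul (jacobsonRad R) ⊤) : Subsingleton (LinearMap.ker p) := by
  obtain ⟨s, hs⟩ := Module.projective_lifting_property p LinearMap.id hp
  have hs' (x : X) : p (s x) = x := LinearMap.congr_fun hs x
  let ρ : A →ₗ[R] LinearMap.ker p :=
    (LinearMap.id - s ∘ₗ p).codRestrict (LinearMap.ker p) fun a => by simp [hs']
  refine subsingleton_of_top_le_jSMul (R := R) fun z _ => ?_
  have hz : ρ z = z := Subtype.ext (by simp [ρ])
  rw [← hz]
  exact (jSMul_map_le _ ρ ⊤).trans (Submodule.span_mono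
    fun _ ⟨r, hr, x, _, e⟩ => ⟨r, hr, x, trivial, e⟩) ⟨z, hker z.2, rfl⟩

/-- Dimension shifting along a surjection from a projective module. -/
theorem hasProjectiveDimensionLT_ker_iff {R : Type} [Ring R] {A X : Type} [AddCommGroup A]
    [Module R A] [AddCommGroup X] [Module R X] [Module.Projective R A] (p : A →ₗ[R] X)
    (hp : Function.Surjective p) (n : ℕ) :
    CategoryTheory.HasProjectiveDimensionLT (ModuleCat.of R X) (n + 2) ↔
      CategoryTheory.HasProjectiveDimensionLT (ModuleCat.of R (LinearMap.ker p)) (n + 1) :=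
  (LinearMap.shortExact_shortComplexKer hp).hasProjectiveDimensionLT_X₃_iff n
    ((IsProjective.iff_projective A).mp ‹_›)

theorem projective_iff_hasProjectiveDimensionLT {R : Type} [Ring R] {X : Type} [AddCommGroup X]
    [Module R X] : Module.Projective R X ↔
      CategoryTheory.HasProjectiveDimensionLT (ModuleCat.of R X) 1 := by
  rw [← CategoryTheory.projective_iff_hasProjectiveDimensionLT_one, IsProjective.iff_projective]

/-- The truncation of a projective resolution, resolving the first syzygy. -/
def ProjRes.tail {R : Type} [Ring R] {X : Type} [AddCommGroup X] [Module R X]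
    (P : ProjRes R X) : ProjRes R (LinearMap.ker P.aug) where
  obj n := P.obj (n + 1)
  proj n := P.proj (n + 1)
  d n := P.d (n + 1)
  aug := (P.d 0).codRestrict _ fun x => P.exact0.le ⟨x, rfl⟩
  aug_surj := by
    rintro ⟨y, hy⟩
    obtain ⟨x, hx⟩ := P.exact0.ge hy
    exact ⟨x, Subtype.ext hx⟩
  exact0 := by rw [LinearMap.ker_codRestrict, P.exact]
  exact n := P.exact (n + 1)

/-- The truncation of a minimal projective resolution, resolving the first syzygy. -/
def MinProjRes.tail {R : Type} [Ring R] {J : Ideal R} {X : Type} [AddCommGroup X] [Module R X]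
    (P : MinProjRes R J X) : MinProjRes R J (LinearMap.ker P.aug) where
  obj n := P.obj (n + 1)
  proj n := P.proj (n + 1)
  fin n := P.fin (n + 1)
  d n := P.d (n + 1)
  aug := (P.d 0).codRestrict _ fun x => P.exact0.le ⟨x, rfl⟩
  aug_surj := by
    rintro ⟨y, hy⟩
    obtain ⟨x, hx⟩ := P.exact0.ge hy
    exact ⟨x, Subtype.ext hx⟩
  exact0 := by rw [LinearMap.ker_codRestrict, P.exact]
  exact n := P.exact (n + 1)
  minimal0 := by rw [LinearMap.ker_codRestrict]; exact P.minimal 0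
  minimal n := P.minimal (n + 1)

/-- A minimal projective resolution, with minimality forgotten. -/
def MinProjRes.toProjRes {R : Type} [Ring R] {J : Ideal R} {X : Type} [AddCommGroup X]
    [Module R X] (P : MinProjRes R J X) : ProjRes R X where
  obj := P.obj
  proj := P.proj
  d := P.d
  aug := P.aug
  aug_surj := P.aug_surj
  exact0 := P.exact0
  exact := P.exact

theorem ProjRes.LengthLE.hasProjectiveDimensionLT {R : Type} [Ring R] {n : ℕ} {X : Type}
    [AddCommGroup X] [Module R X] {P : ProjRes R X} (hP : P.LengthLE n) :
    CategoryTheory.HasProjectiveDimensionLT (ModuleCat.of R X) (n + 1) := by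
  have := P.proj 0
  induction n generalizing X with
  | zero =>
    refine projective_iff_hasProjectiveDimensionLT.mp ?_
    have hinj : Function.Injective P.aug := by
      rw [← LinearMap.ker_eq_bot, ← P.exact0, LinearMap.range_eq_bot]
      ext x
      rw [hP 1 one_pos x, map_zero, map_zero]
    exact Module.Projective.of_equiv (LinearEquiv.ofBijective P.aug ⟨hinj, P.aug_surj⟩)
  | succ n ih =>
    exact (hasProjectiveDimensionLT_ker_iff P.aug P.aug_surj n).mpr
      (ih (P := P.tail) (fun m hm => hP (m + 1) (by lia)) (P.proj 1))

theorem MinProjRes.subsingleton_obj {R : Type} [Ring R] {X : Type} [AddCommGroup X]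
    [Module R X] (P : MinProjRes R (jacobsonRad R) X) [Subsingleton X] (m : ℕ) :
    Subsingleton (P.obj m) := by
  have := P.fin m
  induction m generalizing X with
  | zero =>
    exact subsingleton_of_top_le_jSMul (le_trans (fun x _ => Subsingleton.elim _ _) P.minimal0)
  | succ m ih =>
    have : Subsingleton (P.obj 0) := by
      have := P.fin 0
      exact subsingleton_of_top_le_jSMul (le_trans (fun x _ => Subsingleton.elim _ _) P.minimal0)
    exact ih P.tail (P.fin (m + 1))

theorem MinProjRes.obj_eq_zero_of_hasProjectiveDimensionLT {R : Type} [Ring R] {n : ℕ} {X : Type}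
    [AddCommGroup X] [Module R X] (P : MinProjRes R (jacobsonRad R) X)
    (h : CategoryTheory.HasProjectiveDimensionLT (ModuleCat.of R X) (n + 1))
    (m : ℕ) (hm : n < m) (x : P.obj m) : x = 0 := by
  have := P.proj 0
  obtain ⟨m, rfl⟩ := Nat.exists_eq_add_one_of_ne_zero (Nat.ne_zero_of_lt hm)
  induction n generalizing X m with
  | zero =>
    have := projective_iff_hasProjectiveDimensionLT.mpr h
    have := P.tail.fin 0
    have : Module.Finite R (LinearMap.ker P.aug) :=
      .of_surjective P.tail.aug P.tail.aug_surj
    have := subsingleton_ker_of_projective P.aug P.aug_surj P.minimal0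
    have := P.tail.subsingleton_obj m
    exact this.elim x 0
  | succ n ih =>
    obtain ⟨m, rfl⟩ := Nat.exists_eq_add_one_of_ne_zero (n := m) (by lia)
    exact ih P.tail ((hasProjectiveDimensionLT_ker_iff P.aug P.aug_surj n).mp h) (P.proj 1) m
      (by lia) x

theorem MinProjRes.projDim_le_iff {R : Type} [Ring R] {X : Type} [AddCommGroup X] [Module R X]
    (P : MinProjRes R (jacobsonRad R) X) (n : ℕ) :
    projDim R X ≤ n ↔ ∀ m, n < m → ∀ x : P.obj m, x = 0 := by
  refine ⟨fun h => ?_, fun h => sInf_le ⟨n, P.toProjRes, rfl, h⟩⟩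
  obtain ⟨_, ⟨c, Q, rfl, hQ⟩, hc⟩ := sInf_lt_iff.mp
    (h.trans_lt (b := (n : ℕ∞)) (c := ((n + 1 : ℕ) : ℕ∞)) (by exact_mod_cast n.lt_succ_self))
  have hcn : c ≤ n := Nat.lt_succ_iff.mp (by exact_mod_cast hc)
  exact P.obj_eq_zero_of_hasProjectiveDimensionLT
    (ProjRes.LengthLE.hasProjectiveDimensionLT (P := Q) fun m hm => hQ m (hcn.trans_lt hm))

/-- Theorem C(2): if the minimal Horseshoe Lemma holds for
`0 → K → M → N → 0`, then `pd(M) = max {pd(K), pd(N)}`. -/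
theorem projDim_eq_max_of_minimalHorseshoe
    {k : Type} [Field k] {R : Type} [Ring R] [Algebra k R] (ε : R →ₐ[k] k)
    [IsNoetherianRing R] (hsp : Semiperfect R) (J : Ideal R)
    (hJ : J = jacobsonRad R)
    {K M N : Type} [AddCommGroup K] [Module R K] [AddCommGroup M] [Module R M]
    [AddCommGroup N] [Module R N]
    [Module.Finite R K] [Module.Finite R M] [Module.Finite R N]
    (f : K →ₗ[R] M) (g : M →ₗ[R] N)
    (hf : Function.Injective f) (hg : Function.Surjective g)
    (hfg : LinearMap.range f = LinearMap.ker g)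
    (hMHL : MinimalHorseshoe J f g) :
    projDim R M = max (projDim R K) (projDim R N) := by
  subst hJ
  obtain ⟨P, L, Q, φ, ψ, -, -, -, -, hφ, hψ, hex⟩ := hMHL
  refine eq_of_forall_ge_iff fun c => ?_
  induction c with
  | top => simp
  | coe n =>
    rw [max_le_iff, P.projDim_le_iff, L.projDim_le_iff, Q.projDim_le_iff]
    refine ⟨fun h => ⟨fun m hm x => hφ m ?_, fun m hm y => ?_⟩, fun ⟨hP, hQ⟩ m hm y => ?_⟩
    · rw [map_zero]
      exact h m hm _
    · obtain ⟨x, rfl⟩ := hψ m y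
      rw [h m hm x, map_zero]
    · obtain ⟨x, rfl⟩ := (hex m).le (show ψ m y = 0 from hQ m hm _)
      rw [hP m hm x, map_zero]
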